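/- arXiv:2305.19206 — 3 statements merged into one kernel-verified Lean document; each statement's English description precedes it below -/
import Mathlib

section
/- Assume λ₁* = λ₂* = ⋯ = λ_r*, Δ > 0, η ≤ 1/(12·λ₁*), X₀ ∈ R₂, and σ_r(U₀) > 0. Then there exists an absolute constant C > 0 such that for some iteration index t with t ≤ C·max{1, (1/(ηΔ))·log(Δ/(4·σ_r(U₀)²))}, the iterate satisfies σ_r(U_t)² ≥ Δ/4. -/
open Matrix

/-- The largest singular value of a real matrix. -/
noncomputable def sigmaMax {m n : ℕ} (M : Matrix (Fin m) (Fin n) ℝ) : ℝ :=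
  sSup {c : ℝ | ∃ v : EuclideanSpace ℝ (Fin n), ‖v‖ = 1 ∧
    c = ‖(EuclideanSpace.equiv (Fin m) ℝ).symm (M.mulVec ((EuclideanSpace.equiv (Fin n) ℝ) v))‖}

/-- The smallest singular value (the `n`-th largest, for a matrix with `n` columns). -/
noncomputable def sigmaMin {m n : ℕ} (M : Matrix (Fin m) (Fin n) ℝ) : ℝ :=
  sInf {c : ℝ | ∃ v : EuclideanSpace ℝ (Fin n), ‖v‖ = 1 ∧
    c = ‖(EuclideanSpace.equiv (Fin m) ℝ).symm (M.mulVec ((EuclideanSpace.equiv (Fin n) ℝ) v))‖}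

/-- Frobenius norm of a real matrix. -/
noncomputable def frobNorm {m n : ℕ} (M : Matrix (Fin m) (Fin n) ℝ) : ℝ :=
  Real.sqrt (∑ i, ∑ j, (M i j) ^ 2)

/-- Gradient descent iterates `X_{t+1} = X_t + η (Σ - X_t X_tᵀ) X_t`. -/
noncomputable def gdIter {d r : ℕ} (S : Matrix (Fin d) (Fin d) ℝ) (η : ℝ)
    (X0 : Matrix (Fin d) (Fin r) ℝ) : ℕ → Matrix (Fin d) (Fin r) ℝ
  | 0 => X0
  | t + 1 => gdIter S η X0 t +
      η • ((S - gdIter S η X0 t * (gdIter S η X0 t)ᵀ) * gdIter S η X0 t)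

/-- The top `r × r` block `U` (first `r` rows) of `X ∈ ℝ^{d×r}`. -/
def topBlock {d r : ℕ} (h : r ≤ d) (X : Matrix (Fin d) (Fin r) ℝ) :
    Matrix (Fin r) (Fin r) ℝ :=
  fun i j => X (Fin.castLE h i) j

/-- The bottom `(d-r) × r` block `J` (last `d-r` rows) of `X ∈ ℝ^{d×r}`. -/
def botBlock {d r : ℕ} (X : Matrix (Fin d) (Fin r) ℝ) :
    Matrix (Fin (d - r)) (Fin r) ℝ :=
  fun i j => X ⟨r + (i : ℕ), by have := i.isLt; omega⟩ j

/-- The region `R = {X : σ₁(X)² ≤ 2λ₁*, σ₁(J)² ≤ λ_r* − Δ/2, σ_r(U)² ≥ Δ/4}`. -/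
def inR {d r : ℕ} (h : r ≤ d) (lam1 lamr Δ : ℝ) (X : Matrix (Fin d) (Fin r) ℝ) : Prop :=
  sigmaMax X ^ 2 ≤ 2 * lam1 ∧ sigmaMax (botBlock X) ^ 2 ≤ lamr - Δ / 2 ∧
    Δ / 4 ≤ sigmaMin (topBlock h X) ^ 2

/-- The region `R₂ = {X : σ₁(X)² ≤ 2λ₁*, σ₁(J)² ≤ λ_r* − Δ/2}`. -/
def inR2 {d r : ℕ} (lam1 lamr Δ : ℝ) (X : Matrix (Fin d) (Fin r) ℝ) : Prop :=
  sigmaMax X ^ 2 ≤ 2 * lam1 ∧ sigmaMax (botBlock X) ^ 2 ≤ lamr - Δ / 2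

open scoped InnerProductSpace

theorem norm_sq_le_of_inner_apply_le {E : Type*} [NormedAddCommGroup E]
    [InnerProductSpace ℝ E] {B : E →ₗ[ℝ] E} (hB : B.IsSymmetric) {c : ℝ}
    (h0 : ∀ u, 0 ≤ ⟪u, B u⟫_ℝ) (hc : ∀ u, ⟪u, B u⟫_ℝ ≤ c * ‖u‖ ^ 2) (hcpos : 0 < c) (v : E) :
    ‖B v‖ ^ 2 ≤ c * ⟪v, B v⟫_ℝ := by
  have h1 := h0 (c • v - B v)
  have h2 := hc (B v)
  have h3 : ⟪v, B (B v)⟫_ℝ = ‖B v‖ ^ 2 := by rw [← hB, real_inner_self_eq_norm_sq]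
  simp only [map_sub, map_smul, inner_sub_left, inner_sub_right, inner_smul_left,
    inner_smul_right, conj_trivial, h3, real_inner_self_eq_norm_sq] at h1
  nlinarith

section BlockStep

variable {E F G : Type*} [NormedAddCommGroup E] [InnerProductSpace ℝ E] [FiniteDimensional ℝ E]
  [NormedAddCommGroup F] [InnerProductSpace ℝ F] [FiniteDimensional ℝ F]
  [NormedAddCommGroup G] [InnerProductSpace ℝ G] [FiniteDimensional ℝ G]

theorem norm_sq_apply_eq_inner_adjoint (X : E →ₗ[ℝ] F) (v : E) :
    ‖X v‖ ^ 2 = ⟪v, X.adjoint (X v)⟫_ℝ := by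
  rw [LinearMap.adjoint_inner_right, real_inner_self_eq_norm_sq]

theorem norm_sq_adjoint_apply_le {Y : E →ₗ[ℝ] F} {k : ℝ}
    (hk : 0 ≤ k) (hY : ∀ v, ‖Y v‖ ^ 2 ≤ k * ‖v‖ ^ 2) (w : F) : ‖Y.adjoint w‖ ^ 2 ≤ k * ‖w‖ ^ 2 := by
  have h1 : ‖Y.adjoint w‖ ^ 2 = ⟪Y (Y.adjoint w), w⟫_ℝ := by
    rw [← LinearMap.adjoint_inner_right, real_inner_self_eq_norm_sq]
  have h2 := real_inner_le_norm (Y (Y.adjoint w)) w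
  have h3 := hY (Y.adjoint w)
  rcases eq_or_lt_of_le (norm_nonneg (Y.adjoint w)) with h0 | h0
  · rw [← h0]; nlinarith [mul_nonneg hk (sq_nonneg ‖w‖)]
  · have h4 : (‖Y.adjoint w‖ ^ 2) ^ 2 ≤ (k * ‖w‖ ^ 2) * ‖Y.adjoint w‖ ^ 2 := by
      calc (‖Y.adjoint w‖ ^ 2) ^ 2 ≤ (‖Y (Y.adjoint w)‖ * ‖w‖) ^ 2 := by
            gcongr; rw [h1]; exact h2
        _ = ‖Y (Y.adjoint w)‖ ^ 2 * ‖w‖ ^ 2 := by ring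
        _ ≤ (k * ‖Y.adjoint w‖ ^ 2) * ‖w‖ ^ 2 := by gcongr
        _ = _ := by ring
    have h5 : 0 < ‖Y.adjoint w‖ ^ 2 := by positivity
    nlinarith

theorem norm_smul_apply_sub_le (X : E →ₗ[ℝ] F) {η b c : ℝ} (hη : 0 ≤ η) (hb : 0 ≤ b)
    (hX : ∀ v, ‖X v‖ ^ 2 ≤ b * ‖v‖ ^ 2) (hc : 3 * η * b ≤ c) (v : E) :
    ‖c • X v - η • X (X.adjoint (X v))‖ ^ 2 ≤ b * (c - η * b) ^ 2 * ‖v‖ ^ 2 := by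
  set B : E → E := fun u ↦ b • u - X.adjoint (X u) with hB
  have hq : ∀ u, ⟪u, B u⟫_ℝ = b * ‖u‖ ^ 2 - ‖X u‖ ^ 2 := fun u ↦ by
    rw [hB, norm_sq_apply_eq_inner_adjoint, inner_sub_right, inner_smul_right,
      real_inner_self_eq_norm_sq]
  have hpos : ∀ u, 0 ≤ b * ‖u‖ ^ 2 - ‖X u‖ ^ 2 := fun u ↦ by linarith [hX u]
  have hvec : c • X v - η • X (X.adjoint (X v)) = (c - η * b) • X v + η • X (B v) := by
    simp only [hB, map_sub, map_smul]
    module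
  have hcross : ⟪X v, X (B v)⟫_ℝ = b * ⟪v, B v⟫_ℝ - ‖B v‖ ^ 2 := by
    rw [← LinearMap.adjoint_inner_left, ← real_inner_self_eq_norm_sq (B v)]
    have : X.adjoint (X v) = b • v - B v := by simp [hB]
    rw [this, inner_sub_left, inner_smul_left]; simp
  rw [hvec, norm_add_sq_real, norm_smul, norm_smul, inner_smul_left, inner_smul_right, hcross, hq]
  simp only [Real.norm_eq_abs, mul_pow, sq_abs, conj_trivial]
  have h1 := hpos v
  have h2 := hpos (B v)
  have hηb := mul_nonneg hη hb
  have e1 : 0 ≤ (c - η * b) * (c - 3 * η * b) * (b * ‖v‖ ^ 2 - ‖X v‖ ^ 2) := by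
    apply mul_nonneg (mul_nonneg _ _) h1 <;> linarith
  have e2 : 0 ≤ η * (2 * (c - η * b) - η * b) * ‖B v‖ ^ 2 := by
    apply mul_nonneg (mul_nonneg hη _) (sq_nonneg _); linarith
  have e3 := mul_nonneg (sq_nonneg η) h2
  nlinarith

theorem norm_sub_smul_adjoint_apply_le (Y : E →ₗ[ℝ] F) {η k : ℝ} (hη : 0 ≤ η)
    (hk0 : 0 ≤ k) (hY : ∀ v, ‖Y v‖ ^ 2 ≤ k * ‖v‖ ^ 2) (hk : η * k ≤ 2) (v : E) :
    ‖v - η • Y.adjoint (Y v)‖ ≤ ‖v‖ := by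
  have h := norm_sq_adjoint_apply_le hk0 hY (Y v)
  refine le_of_sq_le_sq ?_ (norm_nonneg _)
  rw [norm_sub_sq_real, inner_smul_right, ← norm_sq_apply_eq_inner_adjoint, norm_smul,
    Real.norm_eq_abs, mul_pow, sq_abs]
  nlinarith [mul_le_mul_of_nonneg_left h (sq_nonneg η),
    mul_nonneg (mul_nonneg hη (sq_nonneg ‖Y v‖)) (sub_nonneg.2 hk)]

/-- One gradient step on the block `Z`, where `Y` is the complementary block and `D` the part of
the target acting on `Z`. -/
noncomputable def blockStep (η : ℝ) (D : F →ₗ[ℝ] F) (Z : E →ₗ[ℝ] F) (Y : E →ₗ[ℝ] G) :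
    E →ₗ[ℝ] F :=
  Z + η • (D ∘ₗ Z - Z ∘ₗ Z.adjoint ∘ₗ Z - Z ∘ₗ Y.adjoint ∘ₗ Y)

theorem norm_blockStep_apply_sq_le {η b k ρ : ℝ} {D : F →ₗ[ℝ] F} {Z : E →ₗ[ℝ] F}
    {Y : E →ₗ[ℝ] G} (hη : 0 ≤ η) (hb : 0 ≤ b) (hk : 0 ≤ k)
    (hD : ∀ v, ‖D v‖ ≤ ρ * ‖v‖) (hρ : ρ ≤ b)
    (hZ : ∀ v, ‖Z v‖ ^ 2 ≤ b * ‖v‖ ^ 2) (hY : ∀ v, ‖Y v‖ ^ 2 ≤ k * ‖v‖ ^ 2)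
    (hηb : 6 * η * b ≤ 1) (hηk : η * k ≤ 1) (v : E) :
    ‖blockStep η D Z Y v‖ ^ 2 ≤ b * ‖v‖ ^ 2 := by
  have hs : ∀ u, ‖Z u‖ ≤ √b * ‖u‖ := fun u ↦ by
    refine le_of_sq_le_sq ?_ (by positivity)
    rw [mul_pow, Real.sq_sqrt hb]; exact hZ u
  have h1 : ‖(1 / 2 : ℝ) • Z v - η • Z (Z.adjoint (Z v))‖ ≤ √b * (1 / 2 - η * b) * ‖v‖ := by
    refine le_of_sq_le_sq ?_
      (mul_nonneg (mul_nonneg (Real.sqrt_nonneg _) (by nlinarith)) (norm_nonneg _))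
    rw [mul_pow, mul_pow, Real.sq_sqrt hb]
    exact norm_smul_apply_sub_le Z hη hb hZ (by linarith) v
  have h2 : ‖(1 / 2 : ℝ) • Z (v - (2 * η) • Y.adjoint (Y v))‖ ≤ 1 / 2 * (√b * ‖v‖) := by
    rw [norm_smul, Real.norm_of_nonneg (by norm_num)]
    gcongr
    refine (hs _).trans ?_
    gcongr
    exact norm_sub_smul_adjoint_apply_le Y (by positivity) hk hY (by linarith) v
  have h3 : ‖η • D (Z v)‖ ≤ η * (b * (√b * ‖v‖)) := by
    rw [norm_smul, Real.norm_of_nonneg hη]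
    gcongr
    exact (hD _).trans (by gcongr; exact hs v)
  have hvec : blockStep η D Z Y v = ((1 / 2 : ℝ) • Z v - η • Z (Z.adjoint (Z v)))
      + (1 / 2 : ℝ) • Z (v - (2 * η) • Y.adjoint (Y v)) + η • D (Z v) := by
    simp only [blockStep, LinearMap.add_apply, LinearMap.smul_apply, LinearMap.sub_apply,
      LinearMap.comp_apply, map_sub, map_smul]
    module
  have h : ‖blockStep η D Z Y v‖ ≤ √b * ‖v‖ := by
    rw [hvec]
    refine norm_add₃_le.trans ?_
    linarith
  calc ‖blockStep η D Z Y v‖ ^ 2 ≤ (√b * ‖v‖) ^ 2 := by gcongr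
    _ = _ := by rw [mul_pow, Real.sq_sqrt hb]

theorem le_norm_adjoint_blockStep_apply_sq {η l b m s : ℝ} {U : E →ₗ[ℝ] F} {J : E →ₗ[ℝ] G}
    (hη : 0 ≤ η) (hb : 0 < b) (hs0 : 0 ≤ s)
    (hU : ∀ v, ‖U v‖ ^ 2 ≤ b * ‖v‖ ^ 2) (hJ : ∀ v, ‖J v‖ ^ 2 ≤ m * ‖v‖ ^ 2)
    (hs : ∀ w, s * ‖w‖ ^ 2 ≤ ‖U.adjoint w‖ ^ 2) (hsm : 2 * s ≤ l - m)
    (hηb : 2 * η * b + 4 * η * s ≤ 1) (w : F) :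
    s * (1 + η * (l - m)) * ‖w‖ ^ 2 ≤
      ‖(blockStep η (l • LinearMap.id) U J).adjoint w‖ ^ 2 := by
  set z := U.adjoint w with hz
  set N : E := l • z - U.adjoint (U z) - J.adjoint (J z) with hN
  have hadj : (blockStep η (l • LinearMap.id) U J).adjoint w = z + η • N := by
    simp only [blockStep, map_add, map_sub, map_smul, LinearMap.adjoint_comp,
      LinearMap.adjoint_adjoint, LinearMap.add_apply, LinearMap.sub_apply, LinearMap.smul_apply,
      LinearMap.comp_apply, LinearMap.smul_comp, LinearMap.id_comp, hN, hz]
  have hzN : ⟪z, N⟫_ℝ = l * ‖z‖ ^ 2 - ‖U z‖ ^ 2 - ‖J z‖ ^ 2 := by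
    rw [hN, inner_sub_right, inner_sub_right, inner_smul_right, real_inner_self_eq_norm_sq,
      ← norm_sq_apply_eq_inner_adjoint, ← norm_sq_apply_eq_inner_adjoint]
  have hlow : (1 + 2 * η * (l - m)) * ‖z‖ ^ 2 - 2 * η * ‖U z‖ ^ 2 ≤ ‖z + η • N‖ ^ 2 := by
    rw [norm_add_sq_real, inner_smul_right, hzN]
    nlinarith [sq_nonneg ‖η • N‖, mul_le_mul_of_nonneg_left (hJ z) hη]
  set B : F →ₗ[ℝ] F := U ∘ₗ U.adjoint - s • LinearMap.id with hB
  have hBq : ∀ u, ⟪u, B u⟫_ℝ = ‖U.adjoint u‖ ^ 2 - s * ‖u‖ ^ 2 := fun u ↦ by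
    simp only [hB, LinearMap.sub_apply, LinearMap.comp_apply, LinearMap.smul_apply,
      LinearMap.id_apply, inner_sub_right, inner_smul_right, real_inner_self_eq_norm_sq]
    rw [← LinearMap.adjoint_inner_left, real_inner_self_eq_norm_sq]
  have hBsymm : B.IsSymmetric := fun x y ↦ by
    simp only [hB, LinearMap.sub_apply, LinearMap.comp_apply, LinearMap.smul_apply,
      LinearMap.id_apply, inner_sub_right, inner_sub_left, inner_smul_right, inner_smul_left,
      conj_trivial]
    rw [← LinearMap.adjoint_inner_right U, LinearMap.adjoint_inner_left]
  have hBsq := norm_sq_le_of_inner_apply_le hBsymm (c := b)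
    (fun u ↦ by rw [hBq]; linarith [hs u])
    (fun u ↦ by
      rw [hBq]; linarith [norm_sq_adjoint_apply_le hb.le hU u, mul_nonneg hs0 (sq_nonneg ‖u‖)]) hb w
  have hBn : ‖B w‖ ^ 2 = ‖U z‖ ^ 2 - 2 * s * ‖z‖ ^ 2 + s ^ 2 * ‖w‖ ^ 2 := by
    have : B w = U z - s • w := by simp [hB, hz]
    rw [this, norm_sub_sq_real, inner_smul_right, ← LinearMap.adjoint_inner_right, ← hz,
      real_inner_self_eq_norm_sq, norm_smul, Real.norm_eq_abs, mul_pow, sq_abs]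
    ring
  rw [hBq, hBn, ← hz] at hBsq
  rw [hadj]
  have hf : 0 ≤ ‖z‖ ^ 2 - s * ‖w‖ ^ 2 := by linarith [hs w]
  have hlm : 0 ≤ l - m := by linarith
  have e1 : 0 ≤ (‖z‖ ^ 2 - s * ‖w‖ ^ 2) * (1 + 2 * η * (l - m) - 2 * η * b - 4 * η * s) :=
    mul_nonneg hf (by linarith [mul_nonneg hη hlm])
  have e2 : 0 ≤ s * ‖w‖ ^ 2 * (η * (l - m - 2 * s)) :=
    mul_nonneg (mul_nonneg hs0 (sq_nonneg _)) (mul_nonneg hη (by linarith))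
  have e3 := mul_le_mul_of_nonneg_left hBsq hη
  nlinarith

theorem le_norm_adjoint_apply_sq {U : E →ₗ[ℝ] E} {s : ℝ} (hs : 0 < s)
    (h : ∀ v, s * ‖v‖ ^ 2 ≤ ‖U v‖ ^ 2) (w : E) : s * ‖w‖ ^ 2 ≤ ‖U.adjoint w‖ ^ 2 := by
  have hinj : Function.Injective U := by
    refine (injective_iff_map_eq_zero _).2 fun v hv ↦ ?_
    have hv' := h v
    rw [hv, norm_zero] at hv'
    by_contra hne
    have : 0 < s * ‖v‖ ^ 2 := by positivity
    linarith
  obtain ⟨z, rfl⟩ := LinearMap.injective_iff_surjective.1 hinj w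
  have h1 : ‖U z‖ ^ 2 ≤ ‖z‖ * ‖U.adjoint (U z)‖ := by
    rw [norm_sq_apply_eq_inner_adjoint]; exact real_inner_le_norm _ _
  rcases eq_or_lt_of_le (norm_nonneg (U z)) with h0 | h0
  · rw [← h0]; simp
  have h2 : 0 < ‖U z‖ ^ 2 := by positivity
  have h3 : (‖U z‖ ^ 2) ^ 2 ≤ ‖z‖ ^ 2 * ‖U.adjoint (U z)‖ ^ 2 := by
    rw [← mul_pow]; gcongr
  refine le_of_mul_le_mul_right ?_ h2
  calc s * ‖U z‖ ^ 2 * ‖U z‖ ^ 2 = s * (‖U z‖ ^ 2) ^ 2 := by ring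
    _ ≤ s * (‖z‖ ^ 2 * ‖U.adjoint (U z)‖ ^ 2) := by gcongr
    _ = (s * ‖z‖ ^ 2) * ‖U.adjoint (U z)‖ ^ 2 := by ring
    _ ≤ ‖U z‖ ^ 2 * ‖U.adjoint (U z)‖ ^ 2 := by gcongr; exact h z
    _ = _ := by ring

end BlockStep

theorem norm_toEuclideanLin_apply_le {m n : ℕ} (M : Matrix (Fin m) (Fin n) ℝ)
    (v : EuclideanSpace ℝ (Fin n)) : ‖M.toEuclideanLin v‖ ≤ sigmaMax M * ‖v‖ := by
  rcases eq_or_ne v 0 with rfl | hv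
  · simp
  have hv' : 0 < ‖v‖ := norm_pos_iff.2 hv
  have hle : ‖M.toEuclideanLin (‖v‖⁻¹ • v)‖ ≤ sigmaMax M := by
    refine le_csSup ⟨‖LinearMap.toContinuousLinearMap M.toEuclideanLin‖, ?_⟩
      ⟨‖v‖⁻¹ • v, by rw [norm_smul, norm_inv, norm_norm, inv_mul_cancel₀ hv'.ne'], rfl⟩
    rintro _ ⟨u, hu, rfl⟩
    have := (LinearMap.toContinuousLinearMap M.toEuclideanLin).le_opNorm u
    rw [hu, mul_one] at this
    exact this
  rw [map_smul, norm_smul, norm_inv, norm_norm, inv_mul_le_iff₀ hv'] at hle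
  linarith

theorem norm_toEuclideanLin_apply_sq_le {m n : ℕ} {M : Matrix (Fin m) (Fin n) ℝ} {b : ℝ}
    (h : sigmaMax M ^ 2 ≤ b) (v : EuclideanSpace ℝ (Fin n)) :
    ‖M.toEuclideanLin v‖ ^ 2 ≤ b * ‖v‖ ^ 2 :=
  calc ‖M.toEuclideanLin v‖ ^ 2 ≤ (sigmaMax M * ‖v‖) ^ 2 := by
        gcongr; exact norm_toEuclideanLin_apply_le M v
    _ = sigmaMax M ^ 2 * ‖v‖ ^ 2 := mul_pow ..
    _ ≤ _ := by gcongr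

theorem sigmaMin_mul_norm_le {m n : ℕ} (M : Matrix (Fin m) (Fin n) ℝ)
    (v : EuclideanSpace ℝ (Fin n)) : sigmaMin M * ‖v‖ ≤ ‖M.toEuclideanLin v‖ := by
  rcases eq_or_ne v 0 with rfl | hv
  · simp
  have hv' : 0 < ‖v‖ := norm_pos_iff.2 hv
  have hle : sigmaMin M ≤ ‖M.toEuclideanLin (‖v‖⁻¹ • v)‖ := by
    refine csInf_le ⟨0, ?_⟩
      ⟨‖v‖⁻¹ • v, by rw [norm_smul, norm_inv, norm_norm, inv_mul_cancel₀ hv'.ne'], rfl⟩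
    rintro _ ⟨u, -, rfl⟩
    exact norm_nonneg _
  rw [map_smul, norm_smul, norm_inv, norm_norm, le_inv_mul_iff₀ hv'] at hle
  linarith

theorem le_sigmaMin_sq {m n : ℕ} (hn : 0 < n) {M : Matrix (Fin m) (Fin n) ℝ} {s : ℝ} (hs : 0 ≤ s)
    (h : ∀ v, s * ‖v‖ ^ 2 ≤ ‖M.toEuclideanLin v‖ ^ 2) : s ≤ sigmaMin M ^ 2 := by
  have hle : √s ≤ sigmaMin M := by
    refine le_csInf ⟨_, EuclideanSpace.single ⟨0, hn⟩ 1, by simp, rfl⟩ ?_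
    rintro _ ⟨u, hu, rfl⟩
    refine Real.sqrt_le_left (norm_nonneg _) |>.2 ?_
    have := h u
    rw [hu, one_pow, mul_one] at this
    exact this
  calc s = √s ^ 2 := (Real.sq_sqrt hs).symm
    _ ≤ _ := by gcongr

theorem sum_fin_eq_top_add_bot {α : Type*} [AddCommMonoid α] {d r : ℕ} (h : r ≤ d)
    (f : Fin d → α) :
    ∑ k, f k = ∑ i : Fin r, f (Fin.castLE h i) +
      ∑ i : Fin (d - r), f ⟨r + (i : ℕ), by have := i.isLt; omega⟩ := by
  rw [← (finCongr (Nat.add_sub_cancel' h)).sum_comp, Fin.sum_univ_add]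
  rfl

theorem transpose_mul_self_eq_blocks {d r : ℕ} (h : r ≤ d) (X : Matrix (Fin d) (Fin r) ℝ) :
    Xᵀ * X = (topBlock h X)ᵀ * topBlock h X + (botBlock X)ᵀ * botBlock X := by
  ext i j
  exact sum_fin_eq_top_add_bot h _

theorem norm_topBlock_apply_sq_le {d r : ℕ} (h : r ≤ d) (X : Matrix (Fin d) (Fin r) ℝ)
    (v : EuclideanSpace ℝ (Fin r)) :
    ‖(topBlock h X).toEuclideanLin v‖ ^ 2 ≤ ‖X.toEuclideanLin v‖ ^ 2 := by
  rw [EuclideanSpace.norm_sq_eq, EuclideanSpace.norm_sq_eq, sum_fin_eq_top_add_bot h]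
  exact le_add_of_nonneg_right (Finset.sum_nonneg fun _ _ ↦ sq_nonneg _)

theorem gdIter_succ_apply {d r : ℕ} (h : r ≤ d) (lam : Fin d → ℝ) (η : ℝ)
    (X0 : Matrix (Fin d) (Fin r) ℝ) (t : ℕ) (k : Fin d) (j : Fin r) :
    let X := gdIter (Matrix.diagonal lam) η X0 t
    gdIter (Matrix.diagonal lam) η X0 (t + 1) k j =
      X k j + η * (lam k * X k j - (X * ((topBlock h X)ᵀ * topBlock h X)) k j
        - (X * ((botBlock X)ᵀ * botBlock X)) k j) := by
  intro X
  rw [gdIter, Matrix.sub_mul, Matrix.mul_assoc, transpose_mul_self_eq_blocks h, Matrix.mul_add]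
  simp only [Matrix.add_apply, Matrix.smul_apply, Matrix.sub_apply, Matrix.diagonal_mul,
    smul_eq_mul, X]
  ring

theorem toEuclideanLin_block_step {m n r : ℕ} {Z Z' : Matrix (Fin m) (Fin r) ℝ}
    {Y : Matrix (Fin n) (Fin r) ℝ} {D : Matrix (Fin m) (Fin m) ℝ} {η : ℝ}
    (h : Z' = Z + η • (D * Z - Z * (Zᵀ * Z) - Z * (Yᵀ * Y))) :
    Z'.toEuclideanLin =
      blockStep η D.toEuclideanLin Z.toEuclideanLin Y.toEuclideanLin := by
  simp only [h, blockStep, ← Matrix.toEuclideanLin_conjTranspose_eq_adjoint,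
    Matrix.conjTranspose_eq_transpose_of_trivial, map_add, map_sub, map_smul,
    Matrix.toLpLin_mul_same]

theorem toEuclideanLin_topBlock_gdIter_succ {d r : ℕ} (h : r ≤ d) {lam : Fin d → ℝ} {l : ℝ}
    (hl : ∀ i : Fin d, (i : ℕ) < r → lam i = l) (η : ℝ) (X0 : Matrix (Fin d) (Fin r) ℝ) (t : ℕ) :
    let X := gdIter (Matrix.diagonal lam) η X0 t
    (topBlock h (gdIter (Matrix.diagonal lam) η X0 (t + 1))).toEuclideanLin =
      blockStep η (l • LinearMap.id) (topBlock h X).toEuclideanLin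
        (botBlock X).toEuclideanLin := by
  intro X
  have hD : (l • LinearMap.id : EuclideanSpace ℝ (Fin r) →ₗ[ℝ] EuclideanSpace ℝ (Fin r)) =
      (l • (1 : Matrix (Fin r) (Fin r) ℝ)).toEuclideanLin := by
    rw [map_smul, Matrix.toLpLin_one]
  rw [hD]
  refine toEuclideanLin_block_step ?_
  ext i j
  rw [Matrix.smul_mul, Matrix.one_mul]
  refine (gdIter_succ_apply h lam η X0 t _ j).trans ?_
  rw [hl _ i.isLt]
  rfl

theorem toEuclideanLin_botBlock_gdIter_succ {d r : ℕ} (h : r ≤ d) (lam : Fin d → ℝ) (η : ℝ)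
    (X0 : Matrix (Fin d) (Fin r) ℝ) (t : ℕ) :
    let X := gdIter (Matrix.diagonal lam) η X0 t
    (botBlock (gdIter (Matrix.diagonal lam) η X0 (t + 1))).toEuclideanLin =
      blockStep η (Matrix.diagonal fun i : Fin (d - r) ↦
          lam ⟨r + (i : ℕ), by have := i.isLt; omega⟩).toEuclideanLin
        (botBlock X).toEuclideanLin (topBlock h X).toEuclideanLin := by
  intro X
  refine toEuclideanLin_block_step ?_
  ext i j
  refine (gdIter_succ_apply h lam η X0 t _ j).trans ?_
  rw [sub_right_comm]
  simp only [Matrix.add_apply, Matrix.smul_apply, Matrix.sub_apply, Matrix.diagonal_mul,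
    smul_eq_mul]
  rfl

theorem norm_toEuclideanLin_diagonal_apply_le {n : ℕ} {a : Fin n → ℝ} {ρ : ℝ} (hρ : 0 ≤ ρ)
    (h : ∀ i, |a i| ≤ ρ) (v : EuclideanSpace ℝ (Fin n)) :
    ‖(Matrix.diagonal a).toEuclideanLin v‖ ≤ ρ * ‖v‖ := by
  refine le_of_sq_le_sq ?_ (by positivity)
  rw [mul_pow, EuclideanSpace.norm_sq_eq, EuclideanSpace.norm_sq_eq, Finset.mul_sum]
  refine Finset.sum_le_sum fun i _ ↦ ?_
  rw [Matrix.ofLp_toLpLin, Matrix.toLin'_apply, Matrix.mulVec_diagonal, norm_mul, mul_pow]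
  gcongr
  exact h i

theorem exists_nat_le_five_mul_max_and_le_one_add_pow {x s Δ : ℝ} (hx : 0 < x) (hx1 : x ≤ 1)
    (hs : 0 < s) (hΔ : 0 < Δ) :
    ∃ t : ℕ, (t : ℝ) ≤ 5 * max 1 (1 / (2 * x) * Real.log (Δ / (4 * s))) ∧
      Δ / 4 ≤ s * (1 + x) ^ t := by
  set L := 1 / (2 * x) * Real.log (Δ / (4 * s)) with hL
  refine ⟨⌈4 * L⌉₊, ?_, ?_⟩
  · rcases le_total L 0 with h | h
    · rw [Nat.ceil_eq_zero.2 (by linarith), Nat.cast_zero]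
      have := le_max_left 1 L
      linarith
    · have := (Nat.ceil_lt_add_one (show 0 ≤ 4 * L by linarith)).le
      linarith [le_max_left 1 L, le_max_right 1 L]
  · have hlog : x / 2 ≤ Real.log (1 + x) := by
      refine le_trans ?_ (Real.le_log_one_add_of_nonneg hx.le)
      rw [div_le_div_iff₀ (by norm_num) (by linarith)]
      nlinarith
    have h1 : Real.log (Δ / (4 * s)) ≤ Real.log ((1 + x) ^ ⌈4 * L⌉₊) := by
      rw [Real.log_pow]
      calc Real.log (Δ / (4 * s)) = 4 * L * (x / 2) := by rw [hL]; field_simp; ring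
        _ ≤ ⌈4 * L⌉₊ * (x / 2) := by gcongr; exact Nat.le_ceil _
        _ ≤ _ := by gcongr
    have h2 := (Real.log_le_log_iff (by positivity) (by positivity)).1 h1
    rw [div_le_iff₀ (by positivity)] at h2
    linarith

/-- Lemma 4.2: with equal top eigenvalues, the signal strength `σ_r(U_t)²` exceeds `Δ/4`
within `O(max{1, (1/(ηΔ)) log(Δ/(4σ_r(U₀)²))})` iterations. -/
theorem signal_rises_fast :
    ∃ C : ℝ, 0 < C ∧
      ∀ (d r : ℕ), 0 < r → ∀ (hrd : r < d) (lam : Fin d → ℝ),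
        (∀ i j : Fin d, i ≤ j → lam j ≤ lam i) →
        (∀ i, 0 ≤ lam i) →
        (∀ i : Fin d, (i : ℕ) < r → lam i = lam ⟨0, by omega⟩) →
        ∀ η : ℝ, 0 < η →
        0 < lam ⟨r - 1, by omega⟩ - lam ⟨r, hrd⟩ →
        η ≤ 1 / (12 * lam ⟨0, by omega⟩) →
        ∀ X0 : Matrix (Fin d) (Fin r) ℝ,
        inR2 (lam ⟨0, by omega⟩) (lam ⟨r - 1, by omega⟩)
          (lam ⟨r - 1, by omega⟩ - lam ⟨r, hrd⟩) X0 →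
        0 < sigmaMin (topBlock hrd.le X0) →
        ∃ t : ℕ,
          (t : ℝ) ≤ C * max 1
            ((1 / (η * (lam ⟨r - 1, by omega⟩ - lam ⟨r, hrd⟩))) *
              Real.log ((lam ⟨r - 1, by omega⟩ - lam ⟨r, hrd⟩) /
                (4 * sigmaMin (topBlock hrd.le X0) ^ 2))) ∧
          (lam ⟨r - 1, by omega⟩ - lam ⟨r, hrd⟩) / 4 ≤
            sigmaMin (topBlock hrd.le (gdIter (Matrix.diagonal lam) η X0 t)) ^ 2 := by
  refine ⟨5, by norm_num, fun d r hr hrd lam hanti hnonneg htop η hη hΔ hηl X0 hX0 hσ ↦ ?_⟩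
  have hlr : lam ⟨r - 1, by omega⟩ = lam ⟨0, by omega⟩ := htop _ (by simp; omega)
  rw [hlr] at hΔ hX0 ⊢
  obtain ⟨hX, hJ0⟩ := hX0
  have hρ : 0 ≤ lam ⟨r, hrd⟩ := hnonneg _
  have hD : ∀ i : Fin (d - r), |lam ⟨r + (i : ℕ), by have := i.isLt; omega⟩| ≤ lam ⟨r, hrd⟩ :=
    fun i ↦ by
      rw [abs_of_nonneg (hnonneg _)]
      exact hanti _ _ (Fin.mk_le_mk.2 (Nat.le_add_right _ _))
  set l := lam ⟨0, by omega⟩ with hl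
  set ρ := lam ⟨r, hrd⟩ with hρdef
  set s := sigmaMin (topBlock hrd.le X0) with hs
  have hl0 : 0 < l := by linarith
  have hηl' : 12 * (η * l) ≤ 1 := by
    rw [le_div_iff₀ (by positivity)] at hηl; linarith
  have hηρ : η * ρ ≤ η * l := by gcongr; linarith
  have hηρ0 : 0 ≤ η * ρ := by positivity
  have hJ0' : sigmaMax (botBlock X0) ^ 2 ≤ (l + ρ) / 2 := by linarith
  set X := gdIter (Matrix.diagonal lam) η X0 with hXdef
  have hbound : ∀ t, (∀ v, ‖(topBlock hrd.le (X t)).toEuclideanLin v‖ ^ 2 ≤ 2 * l * ‖v‖ ^ 2) ∧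
      ∀ v, ‖(botBlock (X t)).toEuclideanLin v‖ ^ 2 ≤ (l + ρ) / 2 * ‖v‖ ^ 2 := by
    intro t
    induction t with
    | zero =>
      exact ⟨fun v ↦ (norm_topBlock_apply_sq_le _ _ v).trans
        (norm_toEuclideanLin_apply_sq_le hX v), norm_toEuclideanLin_apply_sq_le hJ0'⟩
    | succ t ih =>
      obtain ⟨hU, hJ⟩ := ih
      constructor
      · intro v
        rw [hXdef, toEuclideanLin_topBlock_gdIter_succ hrd.le htop]
        refine norm_blockStep_apply_sq_le hη.le (by positivity) (by positivity) (ρ := l)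
          (fun v ↦ ?_) (by linarith) hU hJ (by linarith) (by linarith) v
        simp [norm_smul, abs_of_pos hl0]
      · intro v
        rw [hXdef, toEuclideanLin_botBlock_gdIter_succ hrd.le]
        exact norm_blockStep_apply_sq_le hη.le (by positivity) (by positivity)
          (norm_toEuclideanLin_diagonal_apply_le hρ hD) (by linarith) hJ hU (by linarith)
          (by linarith) v
  set x := η * (l - ρ) / 2 with hx
  have hx0 : 0 < x := by positivity
  have hgrow : ∀ t w, min (s ^ 2 * (1 + x) ^ t) ((l - ρ) / 4) * ‖w‖ ^ 2 ≤
      ‖(topBlock hrd.le (X t)).toEuclideanLin.adjoint w‖ ^ 2 := by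
    intro t
    induction t with
    | zero =>
      have hlow : ∀ v, s ^ 2 * ‖v‖ ^ 2 ≤ ‖(topBlock hrd.le X0).toEuclideanLin v‖ ^ 2 :=
        fun v ↦ by rw [← mul_pow]; gcongr; exact sigmaMin_mul_norm_le _ v
      intro w
      refine le_trans ?_ (le_norm_adjoint_apply_sq (by positivity) hlow w)
      gcongr
      simp
    | succ t ih =>
      intro w
      rw [hXdef, toEuclideanLin_topBlock_gdIter_succ hrd.le htop]
      set a := min (s ^ 2 * (1 + x) ^ t) ((l - ρ) / 4) with ha
      have ha0 : 0 < a := lt_min (by positivity) (by positivity)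
      have ha1 : a ≤ (l - ρ) / 4 := min_le_right _ _
      have hηa : η * a ≤ η * l := by gcongr; linarith
      refine le_trans ?_ (le_norm_adjoint_blockStep_apply_sq hη.le (by positivity : 0 < 2 * l)
        ha0.le (hbound t).1 (hbound t).2 ih (by linarith) (by linarith) w)
      gcongr
      have hxe : η * (l - (l + ρ) / 2) = x := by rw [hx]; ring
      rw [hxe]
      rcases min_choice (s ^ 2 * (1 + x) ^ t) ((l - ρ) / 4) with h | h
      · rw [ha, h]
        exact (min_le_left _ _).trans (by rw [pow_succ (1 + x), mul_assoc])
      · rw [ha, h]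
        exact (min_le_right _ _).trans (le_mul_of_one_le_right (by positivity) (by linarith))
  obtain ⟨t, ht, hst⟩ := exists_nat_le_five_mul_max_and_le_one_add_pow hx0 (by
    have : x ≤ η * l := by rw [hx]; linarith
    linarith) (pow_pos hσ 2) hΔ
  refine ⟨t, ?_, ?_⟩
  · rwa [hx, mul_div_cancel₀ _ two_ne_zero] at ht
  · refine le_sigmaMin_sq hr (by positivity) fun v ↦ ?_
    have h := hgrow t
    rw [min_eq_right hst] at h
    have := le_norm_adjoint_apply_sq (by positivity) h v
    rwa [LinearMap.adjoint_adjoint] at this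
end

section
/- Let λ₁* > 0, η ≤ 1/(3·λ₁*), and a be any real with √λ₁* ≤ a ≤ 1/√(3η). If σ₁(X_t) ≤ a for some t ≥ 0, then σ₁(X_{t'}) ≤ a for all t' ≥ t. -/
open Matrix

theorem sigmaMax_le_iff {m n : ℕ} (M : Matrix (Fin m) (Fin n) ℝ) {a : ℝ} (ha : 0 ≤ a) :
    sigmaMax M ≤ a ↔ ∀ v : EuclideanSpace ℝ (Fin n), ‖M.toEuclideanLin v‖ ≤ a * ‖v‖ := by
  constructor
  · intro h v
    rcases eq_or_ne v 0 with rfl | hv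
    · simp
    have hv' : 0 < ‖v‖ := norm_pos_iff.mpr hv
    have hbdd : BddAbove {c : ℝ | ∃ v : EuclideanSpace ℝ (Fin n), ‖v‖ = 1 ∧
        c = ‖(EuclideanSpace.equiv (Fin m) ℝ).symm
          (M.mulVec ((EuclideanSpace.equiv (Fin n) ℝ) v))‖} := by
      refine ⟨‖M.toEuclideanLin.toContinuousLinearMap‖, ?_⟩
      rintro c ⟨w, hw, rfl⟩
      have := M.toEuclideanLin.toContinuousLinearMap.le_opNorm w
      rw [hw, mul_one] at this
      exact this
    have h1 : ‖M.toEuclideanLin (‖v‖⁻¹ • v)‖ ≤ a := by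
      refine le_trans (le_csSup hbdd ⟨‖v‖⁻¹ • v, ?_, rfl⟩) h
      rw [norm_smul, norm_inv, norm_norm, inv_mul_cancel₀ hv'.ne']
    rw [map_smul, norm_smul, norm_inv, norm_norm, inv_mul_le_iff₀ hv'] at h1
    linarith
  · intro h
    refine Real.sSup_le ?_ ha
    rintro c ⟨v, hv, rfl⟩
    have := h v
    rw [hv, mul_one] at this
    exact this

theorem norm_toEuclideanLin_diagonal_le {d : ℕ} {lam : Fin d → ℝ} {L : ℝ}
    (h : ∀ i, |lam i| ≤ L) (hL : 0 ≤ L) (v : EuclideanSpace ℝ (Fin d)) :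
    ‖(Matrix.diagonal lam).toEuclideanLin v‖ ≤ L * ‖v‖ := by
  refine le_of_sq_le_sq ?_ (by positivity)
  rw [mul_pow, EuclideanSpace.real_norm_sq_eq, EuclideanSpace.real_norm_sq_eq, Finset.mul_sum]
  refine Finset.sum_le_sum fun i _ => ?_
  rw [Matrix.ofLp_toLpLin, Matrix.toLin'_apply, Matrix.mulVec_diagonal, mul_pow]
  exact mul_le_mul_of_nonneg_right (sq_le_sq.mpr ((h i).trans (le_abs_self L))) (sq_nonneg _)

/-- The map `s ↦ s - η s³` is monotone on `[0, 1/√(3η)]`; this is the corresponding bound for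
`A - η A Aᵀ A` when every singular value of `A` is at most `a`. -/
theorem norm_sub_smul_cube_le {E F : Type*} [NormedAddCommGroup E] [InnerProductSpace ℝ E]
    [NormedAddCommGroup F] [InnerProductSpace ℝ F] (A : E →ₗ[ℝ] F) (B : F →ₗ[ℝ] E)
    (hAB : ∀ x y, inner ℝ (A x) y = inner ℝ x (B y)) {a η : ℝ} (ha : 0 ≤ a) (hη : 0 ≤ η)
    (h3 : 3 * (η * a ^ 2) ≤ 1) (hA : ∀ x, ‖A x‖ ≤ a * ‖x‖) (v : E) :
    ‖A v - η • A (B (A v))‖ ≤ a * (1 - η * a ^ 2) * ‖v‖ := by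
  have hA2 (x : E) : ‖A x‖ ^ 2 ≤ a ^ 2 * ‖x‖ ^ 2 := by
    rw [← mul_pow]; exact pow_le_pow_left₀ (norm_nonneg _) (hA x) 2
  have i1 : inner ℝ v (B (A v)) = ‖A v‖ ^ 2 := by
    rw [← hAB, real_inner_self_eq_norm_sq]
  have i2 : inner ℝ (A v) (A (B (A v))) = ‖B (A v)‖ ^ 2 := by
    rw [real_inner_comm, hAB, real_inner_self_eq_norm_sq]
  have n1 : ‖a ^ 2 • v - B (A v)‖ ^ 2
      = a ^ 4 * ‖v‖ ^ 2 - 2 * a ^ 2 * ‖A v‖ ^ 2 + ‖B (A v)‖ ^ 2 := by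
    rw [norm_sub_sq_real, real_inner_smul_left, i1, norm_smul, Real.norm_eq_abs, mul_pow, sq_abs]
    ring
  have n2 : ‖A (a ^ 2 • v - B (A v))‖ ^ 2
      = a ^ 4 * ‖A v‖ ^ 2 - 2 * a ^ 2 * ‖B (A v)‖ ^ 2 + ‖A (B (A v))‖ ^ 2 := by
    rw [map_sub, map_smul, norm_sub_sq_real, real_inner_smul_left, i2, norm_smul,
      Real.norm_eq_abs, mul_pow, sq_abs]
    ring
  have n3 : ‖A v - η • A (B (A v))‖ ^ 2
      = ‖A v‖ ^ 2 - 2 * η * ‖B (A v)‖ ^ 2 + η ^ 2 * ‖A (B (A v))‖ ^ 2 := by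
    rw [norm_sub_sq_real, real_inner_smul_right, i2, norm_smul, Real.norm_eq_abs, mul_pow, sq_abs]
    ring
  have h0 := sub_nonneg.mpr (hA2 v)
  have h1 := sq_nonneg ‖a ^ 2 • v - B (A v)‖
  have h2 := sub_nonneg.mpr (hA2 (a ^ 2 • v - B (A v)))
  rw [n1] at h1
  rw [n1, n2] at h2
  have c0 : 0 ≤ (1 - η * a ^ 2) * (1 - 3 * (η * a ^ 2)) :=
    mul_nonneg (by nlinarith [sq_nonneg a]) (by linarith)
  have c1 : 0 ≤ η * (2 - 3 * (η * a ^ 2)) := mul_nonneg hη (by linarith)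
  refine le_of_sq_le_sq ?_ (mul_nonneg (mul_nonneg ha (by nlinarith [sq_nonneg a])) (norm_nonneg _))
  rw [n3]
  linear_combination mul_nonneg c0 h0 + mul_nonneg c1 h1 + mul_nonneg (sq_nonneg η) h2

theorem sigmaMax_gradient_step_le {d r : ℕ} {S : Matrix (Fin d) (Fin d) ℝ}
    {X : Matrix (Fin d) (Fin r) ℝ} {a η L : ℝ} (ha : 0 ≤ a) (hη : 0 ≤ η)
    (h3 : 3 * (η * a ^ 2) ≤ 1) (hLa : L ≤ a ^ 2)
    (hS : ∀ v, ‖S.toEuclideanLin v‖ ≤ L * ‖v‖) (hX : sigmaMax X ≤ a) :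
    sigmaMax (X + η • ((S - X * Xᵀ) * X)) ≤ a := by
  rw [sigmaMax_le_iff _ ha] at hX ⊢
  intro v
  have hadj (x : EuclideanSpace ℝ (Fin r)) (y : EuclideanSpace ℝ (Fin d)) :
      inner ℝ (X.toEuclideanLin x) y = inner ℝ x (Xᵀ.toEuclideanLin y) := by
    rw [← Matrix.conjTranspose_eq_transpose_of_trivial,
      Matrix.toEuclideanLin_conjTranspose_eq_adjoint, LinearMap.adjoint_inner_right]
  have hdecomp : (X + η • ((S - X * Xᵀ) * X)).toEuclideanLin v
      = (X.toEuclideanLin v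
          - η • X.toEuclideanLin (Xᵀ.toEuclideanLin (X.toEuclideanLin v)))
        + η • S.toEuclideanLin (X.toEuclideanLin v) := by
    ext i
    simp only [Matrix.toLpLin_apply, PiLp.add_apply, PiLp.sub_apply, PiLp.smul_apply,
      Matrix.add_mulVec, Matrix.smul_mulVec, Matrix.sub_mul, Matrix.sub_mulVec,
      Matrix.mulVec_mulVec, Matrix.mul_assoc, Pi.add_apply, Pi.smul_apply, Pi.sub_apply,
      smul_eq_mul]
    ring
  have hcube := norm_sub_smul_cube_le X.toEuclideanLin Xᵀ.toEuclideanLin hadj ha hη h3 hX v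
  have hSX : ‖S.toEuclideanLin (X.toEuclideanLin v)‖ ≤ a ^ 2 * (a * ‖v‖) :=
    (hS _).trans (mul_le_mul hLa (hX v) (norm_nonneg _) (sq_nonneg a))
  calc ‖(X + η • ((S - X * Xᵀ) * X)).toEuclideanLin v‖
      ≤ a * (1 - η * a ^ 2) * ‖v‖ + η * (a ^ 2 * (a * ‖v‖)) := by
        rw [hdecomp]
        refine (norm_add_le _ _).trans (add_le_add hcube ?_)
        rw [norm_smul, Real.norm_eq_abs, abs_of_nonneg hη]
        exact mul_le_mul_of_nonneg_left hSX hη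
    _ = a * ‖v‖ := by ring

/-- Lemma A.1: `{X : σ₁(X) ≤ a}` is absorbing for any `√λ₁* ≤ a ≤ 1/√(3η)`. -/
theorem sigmaMax_absorbing (d r : ℕ) (hr : 0 < r) (hrd : r < d)
    (lam : Fin d → ℝ)
    (hmono : ∀ i j : Fin d, i ≤ j → lam j ≤ lam i)
    (hnn : ∀ i, 0 ≤ lam i)
    (hlam1 : 0 < lam ⟨0, by omega⟩)
    (η : ℝ) (hη : 0 < η)
    (hηle : η ≤ 1 / (3 * lam ⟨0, by omega⟩))
    (a : ℝ) (ha1 : Real.sqrt (lam ⟨0, by omega⟩) ≤ a) (ha2 : a ≤ 1 / Real.sqrt (3 * η))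
    (X0 : Matrix (Fin d) (Fin r) ℝ) (t : ℕ)
    (ht : sigmaMax (gdIter (Matrix.diagonal lam) η X0 t) ≤ a) :
    ∀ t' : ℕ, t ≤ t' → sigmaMax (gdIter (Matrix.diagonal lam) η X0 t') ≤ a := by
  have ha : 0 ≤ a := (Real.sqrt_nonneg _).trans ha1
  have hLa : lam ⟨0, by omega⟩ ≤ a ^ 2 := (Real.sqrt_le_left ha).mp ha1
  have h3 : 3 * (η * a ^ 2) ≤ 1 := by
    have h := pow_le_pow_left₀ ha ha2 2
    rw [div_pow, one_pow, Real.sq_sqrt (by positivity), le_div_iff₀ (by positivity)] at h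
    linarith
  have hS := norm_toEuclideanLin_diagonal_le (lam := lam) (L := lam ⟨0, by omega⟩)
    (fun i => by
      rw [abs_of_nonneg (hnn i)]
      exact hmono _ _ (Fin.mk_le_of_le_val (Nat.zero_le _))) hlam1.le
  intro t' htt'
  induction t', htt' using Nat.le_induction with
  | base => exact ht
  | succ k _ ih => exact sigmaMax_gradient_step_le ha hη.le h3 hLa hS ih
end

section
/- If σ₁(X_t) ≤ 1/√(3η), then σ₁(X_{t+1}) ≤ (1 + η·λ₁* − η·σ₁(X_t)²)·σ₁(X_t). -/
open Matrix

open scoped Matrix.Norms.L2Operator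

theorem ContinuousLinearMap.norm_sub_smul_comp_adjoint_comp_le {E F : Type*}
    [NormedAddCommGroup E] [InnerProductSpace ℝ E] [CompleteSpace E]
    [NormedAddCommGroup F] [InnerProductSpace ℝ F] [CompleteSpace F]
    (T : E →L[ℝ] F) {η : ℝ} (hη : 0 ≤ η) (h : 3 * η * ‖T‖ ^ 2 ≤ 1) :
    ‖T - η • (T ∘L (ContinuousLinearMap.adjoint T) ∘L T)‖ ≤ ‖T‖ - η * ‖T‖ ^ 3 := by
  have hnn : 0 ≤ ‖T‖ - η * ‖T‖ ^ 3 := by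
    have : 0 ≤ ‖T‖ * (1 - η * ‖T‖ ^ 2) :=
      mul_nonneg (norm_nonneg _) (by nlinarith [mul_nonneg hη (sq_nonneg ‖T‖)])
    linarith
  refine ContinuousLinearMap.opNorm_le_bound _ hnn fun v => ?_
  refine le_of_sq_le_sq ?_ (mul_nonneg hnn (norm_nonneg v))
  set u := ContinuousLinearMap.adjoint T (T v) with hu
  have hvu : inner ℝ v u = ‖T v‖ ^ 2 := by
    rw [hu, ContinuousLinearMap.adjoint_inner_right, real_inner_self_eq_norm_sq]
  have hTvu : inner ℝ (T v) (T u) = ‖u‖ ^ 2 := by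
    rw [← ContinuousLinearMap.adjoint_inner_left, ← hu, real_inner_self_eq_norm_sq]
  have hbound (x : E) : ‖T x‖ ^ 2 ≤ ‖T‖ ^ 2 * ‖x‖ ^ 2 := by
    rw [← mul_pow]
    exact pow_le_pow_left₀ (norm_nonneg _) (T.le_opNorm x) 2
  have happ : (T - η • (T ∘L (ContinuousLinearMap.adjoint T) ∘L T)) v = T v - η • T u := by
    simp [hu]
  have hlhs : ‖T v - η • T u‖ ^ 2 = ‖T v‖ ^ 2 - 2 * η * ‖u‖ ^ 2 + η ^ 2 * ‖T u‖ ^ 2 := by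
    rw [norm_sub_sq_real, inner_smul_right, hTvu, norm_smul, mul_pow, Real.norm_eq_abs, sq_abs]
    ring
  set S := ‖T‖ ^ 2 with hS
  have hS0 : 0 ≤ S := sq_nonneg _
  have hw : ‖S • v - u‖ ^ 2 = S ^ 2 * ‖v‖ ^ 2 - 2 * S * ‖T v‖ ^ 2 + ‖u‖ ^ 2 := by
    rw [norm_sub_sq_real, real_inner_smul_left, hvu, norm_smul, mul_pow, Real.norm_eq_abs, sq_abs]
    ring
  have hTw : ‖T (S • v - u)‖ ^ 2 = S ^ 2 * ‖T v‖ ^ 2 - 2 * S * ‖u‖ ^ 2 + ‖T u‖ ^ 2 := by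
    rw [map_sub, map_smul, norm_sub_sq_real, real_inner_smul_left, hTvu, norm_smul, mul_pow,
      Real.norm_eq_abs, sq_abs]
    ring
  have h1 := hbound v
  have h2 := sq_nonneg ‖S • v - u‖
  have h3 := hbound (S • v - u)
  rw [hw] at h2
  rw [hTw, hw] at h3
  have hηS : 0 ≤ η * S := mul_nonneg hη hS0
  have k1 := mul_nonneg (mul_nonneg (show 0 ≤ 1 - η * S by linarith)
    (show 0 ≤ 1 - 3 * η * S by linarith)) (sub_nonneg.2 h1)
  have k2 := mul_nonneg (mul_nonneg hη (show 0 ≤ 2 - 3 * η * S by linarith)) h2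
  have k3 := mul_nonneg (sq_nonneg η) (sub_nonneg.2 h3)
  have hrhs : ((‖T‖ - η * ‖T‖ ^ 3) * ‖v‖) ^ 2 = S * (1 - η * S) ^ 2 * ‖v‖ ^ 2 := by
    rw [hS]
    ring
  rw [happ, hlhs, hrhs]
  linarith

theorem sigmaMax_eq_l2_opNorm {m n : ℕ} (M : Matrix (Fin m) (Fin n) ℝ) : sigmaMax M = ‖M‖ := by
  have hub : ∀ c ∈ {c : ℝ | ∃ v : EuclideanSpace ℝ (Fin n), ‖v‖ = 1 ∧
      c = ‖(EuclideanSpace.equiv (Fin m) ℝ).symm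
        (M.mulVec ((EuclideanSpace.equiv (Fin n) ℝ) v))‖}, c ≤ ‖M‖ := by
    rintro c ⟨v, hv, rfl⟩
    exact (Matrix.l2_opNorm_mulVec M v).trans_eq (by rw [hv, mul_one])
  refine le_antisymm (Real.sSup_le hub (norm_nonneg _)) ?_
  rw [Matrix.l2_opNorm_def]
  refine ContinuousLinearMap.opNorm_le_of_unit_norm
    (Real.sSup_nonneg (by rintro c ⟨v, -, rfl⟩; exact norm_nonneg _)) fun v hv => ?_
  exact le_csSup ⟨_, hub⟩ ⟨v, hv, rfl⟩

theorem Matrix.l2_opNorm_sub_smul_mul_transpose_mul_le {m n : ℕ} (X : Matrix (Fin m) (Fin n) ℝ)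
    {η : ℝ} (hη : 0 ≤ η) (h : 3 * η * ‖X‖ ^ 2 ≤ 1) :
    ‖X - η • (X * Xᵀ * X)‖ ≤ ‖X‖ - η * ‖X‖ ^ 3 := by
  let φ {p q : ℕ} (M : Matrix (Fin p) (Fin q) ℝ) :
      EuclideanSpace ℝ (Fin q) →L[ℝ] EuclideanSpace ℝ (Fin p) :=
    LinearMap.toContinuousLinearMap (Matrix.toEuclideanLin M)
  have hadj : ContinuousLinearMap.adjoint (φ X) = φ Xᵀ := by
    simp only [φ]
    rw [← Matrix.conjTranspose_eq_transpose_of_trivial,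
      Matrix.toEuclideanLin_conjTranspose_eq_adjoint]
    rfl
  have hφ : φ (X - η • (X * Xᵀ * X)) =
      φ X - η • (φ X ∘L ContinuousLinearMap.adjoint (φ X) ∘L φ X) := by
    rw [hadj]
    ext v i
    simp [φ, Matrix.mul_assoc]
  have key := (φ X).norm_sub_smul_comp_adjoint_comp_le hη h
  rw [← hφ] at key
  exact key

/-- Lemma A.4: one-step upper bound on the largest singular value. -/
theorem sigmaMax_one_step (d r : ℕ) (hr : 0 < r) (hrd : r < d)
    (lam : Fin d → ℝ)
    (hmono : ∀ i j : Fin d, i ≤ j → lam j ≤ lam i)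
    (hnn : ∀ i, 0 ≤ lam i)
    (η : ℝ) (hη : 0 < η)
    (X0 : Matrix (Fin d) (Fin r) ℝ) (t : ℕ)
    (hXt : sigmaMax (gdIter (Matrix.diagonal lam) η X0 t) ≤ 1 / Real.sqrt (3 * η)) :
    sigmaMax (gdIter (Matrix.diagonal lam) η X0 (t + 1)) ≤
      (1 + η * lam ⟨0, by omega⟩ - η * sigmaMax (gdIter (Matrix.diagonal lam) η X0 t) ^ 2) *
        sigmaMax (gdIter (Matrix.diagonal lam) η X0 t) := by
  simp only [gdIter]
  generalize gdIter (Matrix.diagonal lam) η X0 t = X at hXt ⊢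
  simp only [sigmaMax_eq_l2_opNorm] at hXt ⊢
  have h : 3 * η * ‖X‖ ^ 2 ≤ 1 := by
    have h3 : 0 < 3 * η := by positivity
    rw [le_div_iff₀ (Real.sqrt_pos.2 h3)] at hXt
    have := pow_le_pow_left₀ (by positivity) hXt 2
    rw [mul_pow, Real.sq_sqrt h3.le] at this
    linarith
  have hdiag : ‖Matrix.diagonal lam‖ ≤ lam ⟨0, by omega⟩ := by
    rw [Matrix.l2_opNorm_diagonal, pi_norm_le_iff_of_nonneg (hnn _)]
    intro i
    rw [Real.norm_of_nonneg (hnn i)]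
    exact hmono _ _ (Nat.zero_le _)
  have hsplit : X + η • ((Matrix.diagonal lam - X * Xᵀ) * X) =
      (X - η • (X * Xᵀ * X)) + η • (Matrix.diagonal lam * X) := by
    rw [Matrix.sub_mul, smul_sub]
    abel
  have hlin : ‖η • (Matrix.diagonal lam * X)‖ ≤ η * (lam ⟨0, by omega⟩ * ‖X‖) := by
    rw [norm_smul, Real.norm_of_nonneg hη.le]
    gcongr
    exact (Matrix.l2_opNorm_mul _ _).trans (by gcongr)
  rw [hsplit]
  have := norm_add_le (X - η • (X * Xᵀ * X)) (η • (Matrix.diagonal lam * X))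
  have := Matrix.l2_opNorm_sub_smul_mul_transpose_mul_le X hη.le h
  linarith
end
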